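/- For all n ≥ 4 with n ≡ 1 or 2 (mod 3), there exists a universal cycle on 3-multisets of [n]. -/

import Mathlib

/-- The cyclic `t`-window of the string `w` starting at position `i`, as a multiset. -/
def cycWindow (w : List ℕ) (t i : ℕ) : Multiset ℕ :=
  ((List.range t).map (fun j => w.getD ((i + j) % w.length) 0) : List ℕ)

/-- The list of all cyclic `t`-windows of the string `w`. -/
def cycWindows (w : List ℕ) (t : ℕ) : List (Multiset ℕ) :=
  (List.range w.length).map (cycWindow w t)

/-- The list of all (non-cyclic) `t`-windows of the linear string `w`. -/
def linWindows (w : List ℕ) (t : ℕ) : List (Multiset ℕ) :=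
  (List.range (w.length + 1 - t)).map
    (fun i => ((List.range t).map (fun j => w.getD (i + j) 0) : List ℕ))

/-- `w` is a universal cycle on `t`-multisets over `[n] = {1,…,n}`. -/
def IsUcycle (n t : ℕ) (w : List ℕ) : Prop :=
  w ≠ [] ∧ (∀ x ∈ w, x ∈ Finset.Icc 1 n) ∧ (cycWindows w t).Nodup ∧
  ∀ m : Multiset ℕ, m ∈ cycWindows w t ↔
    (Multiset.card m = t ∧ ∀ x ∈ m, x ∈ Finset.Icc 1 n)

/-- `w` is a universal cycle on `t`-subsets of `[n] = {1,…,n}`. -/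
def IsUcycleSet (n t : ℕ) (w : List ℕ) : Prop :=
  w ≠ [] ∧ (∀ x ∈ w, x ∈ Finset.Icc 1 n) ∧ (cycWindows w t).Nodup ∧
  ∀ m : Multiset ℕ, m ∈ cycWindows w t ↔
    (m.Nodup ∧ Multiset.card m = t ∧ ∀ x ∈ m, x ∈ Finset.Icc 1 n)

/-- The unordered pair `{x,y}` appears as (cyclically) consecutive characters of `w`. -/
def ConsecPair (w : List ℕ) (x y : ℕ) : Prop :=
  ∃ i < w.length, ({w.getD i 0, w.getD ((i + 1) % w.length) 0} : Multiset ℕ) = {x, y}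

namespace UC3

/-- Linear 3-windows, recursively. -/
def lw : List ℕ → List (Multiset ℕ)
  | a :: b :: c :: l => {a, b, c} :: lw (b :: c :: l)
  | _ => []

/-- Consecutive ordered pairs. -/
def pr : List ℕ → List (ℕ × ℕ)
  | a :: b :: l => (a, b) :: pr (b :: l)
  | _ => []

lemma lw_glue (p q : ℕ) (B : List ℕ) : ∀ A : List ℕ,
    lw (A ++ p :: q :: B) = lw (A ++ [p, q]) ++ lw (p :: q :: B)
  | [] => by simp [lw]
  | [a] => by simp [lw]
  | [a, b] => by simp [lw]
  | a :: b :: c :: A => by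
    have := lw_glue p q B (b :: c :: A)
    simp only [List.cons_append, lw] at this ⊢
    rw [this]

lemma pr_glue (p : ℕ) (B : List ℕ) : ∀ A : List ℕ,
    pr (A ++ p :: B) = pr (A ++ [p]) ++ pr (p :: B)
  | [] => by simp [pr]
  | [a] => by simp [pr]
  | a :: b :: A => by
    have := pr_glue p B (b :: A)
    simp only [List.cons_append, pr] at this ⊢
    rw [this]

lemma mem_pr (p q : ℕ) : ∀ L : List ℕ, (p, q) ∈ pr L → ∃ A B, L = A ++ p :: q :: B
  | [], h => by simp [pr] at h
  | [a], h => by simp [pr] at h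
  | a :: b :: l, h => by
    simp only [pr, List.mem_cons, Prod.mk.injEq] at h
    rcases h with ⟨rfl, rfl⟩ | h
    · exact ⟨[], l, rfl⟩
    · obtain ⟨A, B, h⟩ := mem_pr p q (b :: l) h
      exact ⟨a :: A, B, by rw [h]; rfl⟩

lemma lw_map (f : ℕ → ℕ) : ∀ L : List ℕ, lw (L.map f) = (lw L).map (Multiset.map f)
  | [] => by simp [lw]
  | [a] => by simp [lw]
  | [a, b] => by simp [lw]
  | a :: b :: c :: A => by
    have := lw_map f (b :: c :: A)
    simp only [List.map_cons, lw] at this ⊢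
    rw [this]; simp

lemma pr_map (f : ℕ → ℕ) : ∀ L : List ℕ, pr (L.map f) = (pr L).map (Prod.map f f)
  | [] => by simp [pr]
  | [a] => by simp [pr]
  | a :: b :: A => by
    have := pr_map f (b :: A)
    simp only [List.map_cons, pr] at this ⊢
    rw [this]; simp

/-- `L` starts and ends with the pair `p, q`. -/
def IsCl (L : List ℕ) (p q : ℕ) : Prop :=
  (∃ U, L = p :: q :: U) ∧ (∃ V, L = V ++ [p, q])

lemma insert_word {L G : List ℕ} {a b p q : ℕ} (hL : IsCl L a b) (hG : IsCl G p q)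
    (h : (p, q) ∈ pr L) : ∃ L', IsCl L' a b ∧ (lw L').Perm (lw G ++ lw L) ∧
      (∀ x ∈ pr L, x ∈ pr L') ∧ (∀ x ∈ pr G, x ∈ pr L') := by
  obtain ⟨A, B, rfl⟩ := mem_pr p q L h
  obtain ⟨⟨V, rfl⟩, ⟨U, hU⟩⟩ := hG
  have e1 : A ++ (p :: q :: V) ++ B = (A ++ U) ++ p :: q :: B := by
    rw [hU]; simp
  have e2 : A ++ U ++ [p, q] = A ++ p :: q :: V := by rw [hU]; simp
  refine ⟨A ++ (p :: q :: V) ++ B, ⟨?_, ?_⟩, ?_, ?_, ?_⟩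
  · obtain ⟨X, hX⟩ := hL.1
    rcases A with _ | ⟨x, _ | ⟨y, A⟩⟩
    · simp at hX; simp [hX]
    · simp at hX; simp [hX]
    · simp at hX; simp [hX]
  · obtain ⟨X, hX⟩ := hL.2
    rw [e1]
    rcases List.eq_nil_or_concat B with rfl | ⟨B', y, rfl⟩
    · have : [p, q] = [a, b] := (List.append_inj' hX rfl).2
      rw [this]; exact ⟨_, rfl⟩
    · rcases List.eq_nil_or_concat B' with rfl | ⟨B'', z, rfl⟩
      · have : (A ++ [p]) ++ [q, y] = X ++ [a, b] := by simpa using hX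
        have := (List.append_inj' this rfl).2
        exact ⟨A ++ U ++ [p], by rw [← this]; simp⟩
      · have : (A ++ p :: q :: B'') ++ [z, y] = X ++ [a, b] := by simpa using hX
        have := (List.append_inj' this rfl).2
        exact ⟨A ++ U ++ p :: q :: B'', by rw [← this]; simp⟩
  · rw [e1, lw_glue, e2, lw_glue, lw_glue p q B A, List.append_assoc]
    rw [← List.append_assoc, ← List.append_assoc]
    exact List.Perm.append_right _ List.perm_append_comm
  · intro x hx
    rw [pr_glue] at hx
    simp only [pr, List.mem_append, List.mem_cons] at hx
    have f1 : pr (A ++ (p :: q :: V) ++ B) =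
        pr (A ++ [p]) ++ (p, q) :: pr (q :: (V ++ B)) := by
      rw [List.append_assoc, List.cons_append, pr_glue]; simp [pr]
    rcases hx with hx | hx | hx
    · rw [f1]; simp [hx]
    · rw [f1]; simp [hx]
    · rw [e1, pr_glue]; simp [pr, hx]
  · intro x hx
    have f1 : pr (A ++ (p :: q :: V) ++ B) = pr (A ++ U ++ [p]) ++ pr (p :: q :: B) := by
      rw [e1, pr_glue]
    rw [hU] at hx
    have : U ++ [p, q] = U ++ p :: [q] := rfl
    rw [this, pr_glue] at hx
    rw [f1]
    simp only [pr, List.mem_append, List.mem_cons, List.not_mem_nil, or_false] at hx ⊢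
    rcases hx with hx | hx
    · left
      clear e1 e2 f1 this hU hL h
      induction A with
      | nil => exact hx
      | cons a A ih =>
        revert ih
        simp only [List.cons_append]
        rcases hh : A ++ U ++ [p] with _ | ⟨y, t⟩
        · simp at hh
        · intro ih; simp [pr, ih]
    · right; left; exact hx

lemma insert_words {a b : ℕ} (Gs : List (List ℕ)) : ∀ {L : List ℕ}, IsCl L a b →
    (∀ G ∈ Gs, ∃ p q, IsCl G p q ∧ (p, q) ∈ pr L) →
    ∃ L', IsCl L' a b ∧ (lw L').Perm (Gs.flatMap lw ++ lw L) ∧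
      (∀ x ∈ pr L, x ∈ pr L') ∧ (∀ G ∈ Gs, ∀ x ∈ pr G, x ∈ pr L') := by
  induction Gs with
  | nil => intro L hL _; exact ⟨L, hL, by simp, by simp, by simp⟩
  | cons G Gs ih =>
    intro L hL h
    obtain ⟨p, q, hG, hp⟩ := h G (by simp)
    obtain ⟨L1, h1, h2, h3, h4⟩ := insert_word hL hG hp
    obtain ⟨L2, g1, g2, g3, g4⟩ := ih h1 (fun G' hG' => by
      obtain ⟨p, q, u, v⟩ := h G' (by simp [hG'])
      exact ⟨p, q, u, h3 _ v⟩)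
    refine ⟨L2, g1, ?_, fun x hx => g3 _ (h3 _ hx), ?_⟩
    · refine g2.trans ?_
      refine (List.Perm.append_left _ h2).trans ?_
      rw [List.flatMap_cons, ← List.append_assoc]
      exact List.Perm.append_right _ List.perm_append_comm
    · intro G' hG'
      rcases List.mem_cons.1 hG' with rfl | hG'
      · exact fun x hx => g3 _ (h4 _ hx)
      · exact g4 _ hG'

/-- Admissible multisets: size 3, letters at least `s`, group (letter div 3) at most `k`. -/
def Ok (s k : ℕ) (m : Multiset ℕ) : Prop :=
  Multiset.card m = 3 ∧ ∀ x ∈ m, s ≤ x ∧ x / 3 ≤ k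

/-- The set of nonzero groups met by `m`. -/
def gs (m : Multiset ℕ) : Finset ℕ := (m.map (fun x => x / 3)).toFinset.erase 0

lemma mem_gs (m : Multiset ℕ) (i : ℕ) : i ∈ gs m ↔ i ≠ 0 ∧ ∃ x ∈ m, x / 3 = i := by
  simp [gs]

def Covers (P : Multiset ℕ → Prop) (W : List (Multiset ℕ)) : Prop :=
  W.Nodup ∧ ∀ m, m ∈ W ↔ P m

def St (s k : ℕ) (F : Finset (Finset ℕ)) (Q : Set (ℕ × ℕ)) : Prop :=
  ∃ L, IsCl L 2 2 ∧ Covers (fun m => Ok s k m ∧ gs m ∈ F) (lw L) ∧ ∀ x ∈ Q, x ∈ pr L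

def Item (s k : ℕ) (I : Finset ℕ) (Q R : Set (ℕ × ℕ)) : Prop :=
  ∃ Gs : List (List ℕ), (∀ G ∈ Gs, ∃ p q, IsCl G p q ∧ (p, q) ∈ Q) ∧
    Covers (fun m => Ok s k m ∧ gs m = I) (Gs.flatMap lw) ∧ ∀ x ∈ R, ∃ G ∈ Gs, x ∈ pr G

lemma St.step {s k : ℕ} {F : Finset (Finset ℕ)} {Q R : Set (ℕ × ℕ)} {I : Finset ℕ}
    (h : St s k F Q) (hI : I ∉ F) (hi : Item s k I Q R) : St s k (insert I F) (Q ∪ R) := by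
  obtain ⟨L, h1, h2, h3⟩ := h
  obtain ⟨Gs, g1, g2, g3⟩ := hi
  obtain ⟨L', l1, l2, l3, l4⟩ := insert_words Gs h1 (fun G hG => by
    obtain ⟨p, q, u, v⟩ := g1 G hG
    exact ⟨p, q, u, h3 _ v⟩)
  refine ⟨L', l1, ⟨?_, ?_⟩, ?_⟩
  · rw [l2.nodup_iff]
    refine List.Nodup.append g2.1 h2.1 ?_
    intro m hm hm'
    rw [g2.2] at hm
    rw [h2.2] at hm'
    exact hI (hm.2 ▸ hm'.2)
  · intro m
    rw [l2.mem_iff, List.mem_append, g2.2, h2.2]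
    simp only [Finset.mem_insert]
    tauto
  · rintro x (hx | hx)
    · exact l3 _ (h3 _ hx)
    · obtain ⟨G, hG, hx⟩ := g3 _ hx
      exact l4 _ hG _ hx

lemma St.steps {s k : ℕ} {F : Finset (Finset ℕ)} {Q : Set (ℕ × ℕ)}
    {R : Finset ℕ → Set (ℕ × ℕ)} (h : St s k F Q) (T : Finset (Finset ℕ)) :
    (∀ I ∈ T, I ∉ F ∧ Item s k I Q (R I)) →
    St s k (T ∪ F) (Q ∪ {x | ∃ I ∈ T, x ∈ R I}) := by
  classical
  induction T using Finset.induction_on with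
  | empty => intro _; simpa using h
  | insert I T hIT ih =>
    intro hT
    have := ih (fun J hJ => hT J (by simp [hJ]))
    obtain ⟨a, Gs, b, c, d⟩ := hT I (by simp)
    have h2 := this.step (I := I) (R := R I) (by simp [hIT, a])
      ⟨Gs, fun G hG => by
        obtain ⟨p, q, u, v⟩ := b G hG
        exact ⟨p, q, u, Or.inl v⟩, c, d⟩
    rw [Finset.insert_union]
    obtain ⟨L, l1, l2, l3⟩ := h2
    refine ⟨L, l1, l2, ?_⟩
    rintro x (hx | ⟨J, hJ, hx⟩)
    · exact l3 _ (Or.inl (Or.inl hx))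
    · rcases Finset.mem_insert.1 hJ with rfl | hJ
      · exact l3 _ (Or.inr hx)
      · exact l3 _ (Or.inl (Or.inr ⟨J, hJ, hx⟩))

/-- Group relabelling. -/
def phi (e : ℕ → ℕ) (c : ℕ) : ℕ := 3 * e (c / 3) + c % 3

lemma phi_div (e : ℕ → ℕ) (c : ℕ) : phi e c / 3 = e (c / 3) := by
  unfold phi; omega

lemma phi_inj {e : ℕ → ℕ} (he : StrictMono e) : Function.Injective (phi e) := by
  intro a b h
  have h1 : e (a / 3) = e (b / 3) := by rw [← phi_div e, ← phi_div e, h]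
  have h2 := he.injective h1
  unfold phi at h
  omega

lemma gs_map {e : ℕ → ℕ} (he : StrictMono e) (h0 : e 0 = 0) (m : Multiset ℕ) :
    gs (m.map (phi e)) = (gs m).image e := by
  ext i
  simp only [mem_gs, Finset.mem_image, Multiset.mem_map]
  constructor
  · rintro ⟨hi, x, ⟨y, hy, rfl⟩, rfl⟩
    rw [phi_div] at hi ⊢
    exact ⟨y / 3, ⟨fun h => hi (by rw [h, h0]), y, hy, rfl⟩, rfl⟩
  · rintro ⟨j, ⟨hj, y, hy, rfl⟩, rfl⟩
    refine ⟨fun h => hj (he.injective (h.trans h0.symm)), _, ⟨y, hy, rfl⟩, phi_div e y⟩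

/-- Concrete gadget. -/
def Gadget (s r : ℕ) (Gs : List (List ℕ)) : Prop :=
  Covers (fun m => Ok s r m ∧ gs m = Finset.Icc 1 r) (Gs.flatMap lw)

lemma flatMap_lw_map (f : ℕ → ℕ) (Gs : List (List ℕ)) :
    (Gs.map (List.map f)).flatMap lw = (Gs.flatMap lw).map (Multiset.map f) := by
  induction Gs with
  | nil => rfl
  | cons G Gs ih => simp [List.flatMap_cons, lw_map] at ih ⊢; exact ih

lemma Gadget.item {s r k : ℕ} {Gs : List (List ℕ)} (h : Gadget s r Gs) (hs : s ≤ 3)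
    {e : ℕ → ℕ} (he : StrictMono e) (h0 : e 0 = 0) (hk : e r ≤ k) {Q R : Set (ℕ × ℕ)}
    (hQ : ∀ G ∈ Gs, ∃ p q, IsCl G p q ∧ (phi e p, phi e q) ∈ Q)
    (hR : ∀ x ∈ R, ∃ G ∈ Gs, ∃ p q, x = (phi e p, phi e q) ∧ (p, q) ∈ pr G) :
    Item s k ((Finset.Icc 1 r).image e) Q R := by
  refine ⟨Gs.map (List.map (phi e)), ?_, ⟨?_, ?_⟩, ?_⟩
  · intro G hG
    obtain ⟨G, hG0, rfl⟩ := List.mem_map.1 hG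
    obtain ⟨p, q, ⟨⟨U, hU⟩, ⟨V, hV⟩⟩, hpq⟩ := hQ G hG0
    refine ⟨_, _, ⟨⟨U.map (phi e), ?_⟩, ⟨V.map (phi e), ?_⟩⟩, hpq⟩
    · rw [hU]; rfl
    · rw [hV]; simp
  · rw [flatMap_lw_map]
    exact h.1.map (Multiset.map_injective (phi_inj he))
  · intro m
    rw [flatMap_lw_map, List.mem_map]
    constructor
    · rintro ⟨m0, hm0, rfl⟩
      rw [h.2] at hm0
      obtain ⟨⟨h3, hx⟩, hg⟩ := hm0
      refine ⟨⟨by simpa using h3, ?_⟩, by rw [gs_map he h0, hg]⟩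
      intro y hy
      obtain ⟨x, hxm, rfl⟩ := Multiset.mem_map.1 hy
      obtain ⟨a, b⟩ := hx x hxm
      refine ⟨?_, ?_⟩
      · rcases Nat.eq_zero_or_pos (x / 3) with hz | hz
        · unfold phi; rw [hz, h0]; omega
        · have := he hz
          unfold phi; omega
      · rw [phi_div]; exact (he.monotone b).trans hk
    · rintro ⟨⟨h3, hx⟩, hg⟩
      have hdiv : ∀ x ∈ m, ∃ t ≤ r, e t = x / 3 := by
        intro x hxm
        by_cases hz : x / 3 = 0
        · exact ⟨0, by omega, by rw [h0, hz]⟩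
        · have : x / 3 ∈ gs m := (mem_gs _ _).2 ⟨hz, x, hxm, rfl⟩
          rw [hg] at this
          obtain ⟨t, ht, hte⟩ := Finset.mem_image.1 this
          exact ⟨t, (Finset.mem_Icc.1 ht).2, hte⟩
      have hl : ∀ x ∈ m, ∃ y, phi e y = x := by
        intro x hxm
        obtain ⟨t, -, ht⟩ := hdiv x hxm
        refine ⟨3 * t + x % 3, ?_⟩
        unfold phi
        rw [show (3 * t + x % 3) / 3 = t by omega, ht]; omega
      obtain ⟨m0, rfl⟩ : ∃ m0 : Multiset ℕ, m0.map (phi e) = m := by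
        choose! f hf using hl
        refine ⟨m.map f, ?_⟩
        rw [Multiset.map_map]
        conv_rhs => rw [← Multiset.map_id m]
        exact Multiset.map_congr rfl (fun x hx => hf x hx)
      refine ⟨m0, ?_, rfl⟩
      rw [h.2]
      refine ⟨⟨by simpa using h3, ?_⟩, ?_⟩
      · intro y hy
        have hy' := Multiset.mem_map_of_mem (phi e) hy
        obtain ⟨a, b⟩ := hx _ hy'
        obtain ⟨t, ht, hte⟩ := hdiv _ hy'
        rw [phi_div] at hte
        have := he.injective hte
        refine ⟨?_, by omega⟩
        rcases Nat.eq_zero_or_pos (y / 3) with hz | hz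
        · unfold phi at a; rw [hz, h0] at a; omega
        · omega
      · rw [gs_map he h0] at hg
        exact Finset.image_injective he.injective hg
  · intro x hx
    obtain ⟨G, hG, p, q, rfl, hpq⟩ := hR x hx
    refine ⟨G.map (phi e), List.mem_map.2 ⟨G, hG, rfl⟩, ?_⟩
    rw [pr_map]
    exact List.mem_map.2 ⟨_, hpq, rfl⟩

instance (s k : ℕ) (m : Multiset ℕ) : Decidable (Ok s k m) := by unfold Ok; infer_instance

lemma covers_of_check {s r : ℕ} {P : Multiset ℕ → Prop} {W : List (Multiset ℕ)}
    (h1 : W.Nodup) (h2 : ∀ m ∈ W, Ok s r m ∧ P m)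
    (h3 : ∀ a ∈ List.range (3 * r + 3), ∀ b ∈ List.range (a + 1), ∀ c ∈ List.range (b + 1),
      s ≤ c → P {a, b, c} → ({a, b, c} : Multiset ℕ) ∈ W) :
    Covers (fun m => Ok s r m ∧ P m) W := by
  refine ⟨h1, fun m => ⟨h2 m, ?_⟩⟩
  rintro ⟨⟨hc, hx⟩, hP⟩
  obtain ⟨a, b, c, rfl, hab, hbc⟩ : ∃ a b c : ℕ, m = {a, b, c} ∧ b ≤ a ∧ c ≤ b := by
    obtain ⟨a, b, c, rfl⟩ := Multiset.card_eq_three.1 hc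
    have s1 : ∀ x y z : ℕ, ({x, y, z} : Multiset ℕ) = {y, x, z} := fun x y z =>
      Multiset.cons_swap x y {z}
    have s2 : ∀ x y z : ℕ, ({x, y, z} : Multiset ℕ) = {x, z, y} := fun x y z =>
      congrArg (Multiset.cons x) (Multiset.cons_swap y z 0)
    rcases le_total a b with h | h <;> rcases le_total b c with h' | h' <;>
      rcases le_total a c with h'' | h''
    · exact ⟨c, b, a, by rw [s1, s2, s1], h', h⟩
    · exact ⟨c, b, a, by rw [s1, s2, s1], h', h⟩
    · exact ⟨b, c, a, by rw [s1, s2], h', h''⟩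
    · exact ⟨b, a, c, by rw [s1], h, h''⟩
    · exact ⟨c, a, b, by rw [s2, s1], h'', h⟩
    · exact ⟨a, c, b, by rw [s2], h'', h'⟩
    · exact ⟨a, b, c, rfl, h, h'⟩
    · exact ⟨a, b, c, rfl, h, h'⟩
  have ha := hx a (by simp)
  have hcc := hx c (by simp)
  exact h3 a (List.mem_range.2 (by omega)) b (List.mem_range.2 (by omega))
    c (List.mem_range.2 (by omega)) hcc.1 hP

def base1 : List ℕ := [2, 2, 4, 4, 4, 3, 2, 3, 2, 5, 5, 5, 3, 3, 3, 4, 5, 4, 5, 2, 2, 2]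
def base2 : List ℕ := [2, 2, 5, 4, 1, 4, 1, 3, 1, 3, 5, 3, 4, 2, 4, 2, 1, 1, 1, 5, 5, 2, 1, 2,
  3, 5, 5, 5, 4, 4, 4, 3, 3, 3, 2, 2, 2]
def single1 : List ℕ := [2, 2, 4, 4, 4, 5, 2, 5, 2, 3, 3, 3, 5, 5, 5, 4, 3, 4, 3, 2, 2]
def single2 : List ℕ := [2, 2, 4, 5, 4, 5, 3, 5, 3, 2, 3, 2, 1, 5, 1, 3, 3, 3, 4, 2, 4, 1, 1, 3,
  4, 4, 4, 1, 5, 5, 5, 2, 2]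
def pair1 : List ℕ := [2, 3, 8, 6, 5, 2, 8, 4, 5, 6, 7, 4, 2, 6, 3, 5, 8, 5, 8, 7, 4, 4, 6, 6, 5,
  5, 7, 4, 7, 3, 6, 3, 6, 4, 8, 4, 8, 3, 8, 3, 7, 3, 7, 5, 7, 2, 3]
def pair2 : List ℕ := [2, 3, 8, 7, 4, 2, 8, 5, 4, 7, 1, 5, 8, 6, 4, 1, 8, 3, 3, 7, 2, 5, 6, 6, 4,
  4, 8, 8, 3, 4, 6, 5, 5, 7, 6, 3, 6, 3, 8, 5, 8, 5, 7, 7, 3, 5, 6, 1, 3, 7, 4, 7, 4, 6, 2, 3]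
def tri1 : List ℕ := [3, 6, 9, 4, 7, 10, 5, 8, 11, 3, 6]
def tri2 : List ℕ := [5, 6, 10, 3, 7, 11, 4, 8, 9, 5, 6]
def tri3 : List ℕ := [3, 8, 10, 4, 6, 11, 5, 7, 9, 3, 8]

lemma base1_ok : Covers (fun m => Ok 2 1 m ∧ True) (lw base1) :=
  covers_of_check (by decide +kernel) (by decide +kernel) (by decide +kernel)
lemma base2_ok : Covers (fun m => Ok 1 1 m ∧ True) (lw base2) :=
  covers_of_check (by decide +kernel) (by decide +kernel) (by decide +kernel)
lemma single1_ok : Gadget 2 1 [single1] :=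
  covers_of_check (by decide +kernel) (by decide +kernel) (by decide +kernel)
lemma single2_ok : Gadget 1 1 [single2] :=
  covers_of_check (by decide +kernel) (by decide +kernel) (by decide +kernel)
lemma pair1_ok : Gadget 2 2 [pair1] :=
  covers_of_check (by decide +kernel) (by decide +kernel) (by decide +kernel)
lemma pair2_ok : Gadget 1 2 [pair2] :=
  covers_of_check (by decide +kernel) (by decide +kernel) (by decide +kernel)
lemma tri_ok2 : Gadget 2 3 [tri1, tri2, tri3] :=
  covers_of_check (by decide +kernel) (by decide +kernel) (by decide +kernel)
lemma tri_ok1 : Gadget 1 3 [tri1, tri2, tri3] :=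
  covers_of_check (by decide +kernel) (by decide +kernel) (by decide +kernel)

/-- Strictly increasing relabelling sending `1, 2, 3` to `i, j, l`. -/
def ee (i j l : ℕ) : ℕ → ℕ
  | 0 => 0
  | 1 => i
  | 2 => j
  | n + 3 => l + n

lemma ee_mono {i j l : ℕ} (h0 : 0 < i) (h1 : i < j) (h2 : j < l) : StrictMono (ee i j l) := by
  apply strictMono_nat_of_lt_succ
  intro n
  rcases n with _ | _ | _ | n <;> simp [ee] <;> omega

lemma Icc11 : Finset.Icc 1 1 = ({1} : Finset ℕ) := by decide
lemma Icc12 : Finset.Icc 1 2 = ({1, 2} : Finset ℕ) := by decide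
lemma Icc13 : Finset.Icc 1 3 = ({1, 2, 3} : Finset ℕ) := by decide

lemma sorted_two {I : Finset ℕ} (h : I.card = 2) : ∃ i j, i < j ∧ I = {i, j} := by
  obtain ⟨a, b, hab, rfl⟩ := Finset.card_eq_two.1 h
  rcases lt_or_gt_of_ne hab with h | h
  · exact ⟨a, b, h, rfl⟩
  · exact ⟨b, a, h, Finset.pair_comm a b⟩

lemma sorted_three {I : Finset ℕ} (h : I.card = 3) :
    ∃ i j l, i < j ∧ j < l ∧ I = {i, j, l} := by
  obtain ⟨a, b, c, hab, hac, hbc, rfl⟩ := Finset.card_eq_three.1 h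
  rcases lt_or_gt_of_ne hab with h1 | h1 <;> rcases lt_or_gt_of_ne hac with h2 | h2 <;>
    rcases lt_or_gt_of_ne hbc with h3 | h3
  · exact ⟨a, b, c, h1, h3, rfl⟩
  · exact ⟨a, c, b, h2, h3, by ext; simp; tauto⟩
  · omega
  · exact ⟨c, a, b, h2, h1, by ext; simp; tauto⟩
  · exact ⟨b, a, c, h1, h2, by ext; simp; tauto⟩
  · omega
  · exact ⟨b, c, a, h3, h2, by ext; simp; tauto⟩
  · exact ⟨c, b, a, h3, h1, by ext; simp; tauto⟩

lemma full {s k : ℕ} (hs : s ≤ 3) (hk : 1 ≤ k) {base single pair : List ℕ}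
    (hb : Covers (fun m => Ok s 1 m ∧ True) (lw base)) (hb1 : IsCl base 2 2)
    (hb2 : (2, 2) ∈ pr base) (hb3 : (2, 3) ∈ pr base)
    (hsi : Gadget s 1 [single]) (hs1 : IsCl single 2 2) (hs2 : (2, 3) ∈ pr single)
    (hp : Gadget s 2 [pair]) (hp1 : IsCl pair 2 3) (hp2 : (3, 6) ∈ pr pair)
    (hp3 : (5, 6) ∈ pr pair) (hp4 : (3, 8) ∈ pr pair)
    (ht : Gadget s 3 [tri1, tri2, tri3]) :
    ∃ L, IsCl L 2 2 ∧ Covers (Ok s k) (lw L) := by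
  have st0 : St s k {∅, {1}} {(2, 2), (2, 3)} := by
    refine ⟨base, hb1, ⟨hb.1, ?_⟩, ?_⟩
    · intro m
      rw [hb.2]
      have : gs m ∈ ({∅, {1}} : Finset (Finset ℕ)) ↔ ∀ x ∈ m, x / 3 ≤ 1 := by
        rw [Finset.mem_insert, Finset.mem_singleton, ← Finset.subset_singleton_iff]
        constructor
        · intro h x hx
          by_contra hc
          have := h ((mem_gs m (x / 3)).2 ⟨by omega, x, hx, rfl⟩)
          simp at this; omega
        · intro h i hi
          obtain ⟨h0, x, hx, rfl⟩ := (mem_gs m i).1 hi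
          have := h x hx
          simp; omega
      simp only [this, Ok, and_true]
      constructor
      · rintro ⟨a, b⟩
        exact ⟨⟨a, fun x hx => ⟨(b x hx).1, (b x hx).2.trans hk⟩⟩, fun x hx => (b x hx).2⟩
      · rintro ⟨⟨a, b⟩, c⟩
        exact ⟨a, fun x hx => ⟨(b x hx).1, c x hx⟩⟩
    · rintro x (rfl | rfl)
      · exact hb2
      · exact hb3
  have st1 := st0.steps (R := fun I => {x | ∃ i, I = {i} ∧ x = (2, 3 * i)})
    ((Finset.Icc 2 k).image (fun i => ({i} : Finset ℕ))) (by
      intro I hI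
      obtain ⟨i, hi, rfl⟩ := Finset.mem_image.1 hI
      rw [Finset.mem_Icc] at hi
      refine ⟨by simp; omega, ?_⟩
      have := hsi.item (k := k) hs (ee_mono (i := i) (j := i + 1) (l := i + 2) (by omega)
        (by omega) (by omega)) rfl (by simp [ee]; omega) (Q := {(2, 2), (2, 3)})
        (R := {x | ∃ i' : ℕ, ({i} : Finset ℕ) = {i'} ∧ x = (2, 3 * i')})
        (by
          intro G hG
          rw [List.mem_singleton] at hG
          subst hG
          exact ⟨2, 2, hs1, by simp [phi, ee]⟩)
        (by
          rintro x ⟨i', h, rfl⟩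
          rw [Finset.singleton_inj] at h
          subst h
          exact ⟨single, by simp, 2, 3, by simp [phi, ee], hs2⟩)
      rw [Icc11] at this
      simpa [ee] using this)
  set F1 := (Finset.Icc 2 k).image (fun i => ({i} : Finset ℕ)) ∪ {∅, {1}} with hF1
  set Q1 := ({(2, 2), (2, 3)} : Set (ℕ × ℕ)) ∪ {x | ∃ I ∈ (Finset.Icc 2 k).image
    (fun i => ({i} : Finset ℕ)), x ∈ {x | ∃ i, I = {i} ∧ x = (2, 3 * i)}} with hQ1
  have hF1c : ∀ I ∈ F1, I.card ≤ 1 := by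
    intro I hI
    simp only [hF1, Finset.mem_union, Finset.mem_image, Finset.mem_insert,
      Finset.mem_singleton] at hI
    rcases hI with ⟨i, _, rfl⟩ | rfl | rfl <;> simp
  have hQ1m : ∀ i, 1 ≤ i → i ≤ k → (2, 3 * i) ∈ Q1 := by
    intro i h1 h2
    rcases Nat.lt_or_ge 1 i with h | h
    · right
      exact ⟨{i}, Finset.mem_image.2 ⟨i, Finset.mem_Icc.2 ⟨h, h2⟩, rfl⟩, i, rfl, rfl⟩
    · left
      have : i = 1 := by omega
      subst this; simp
  have st2 := st1.steps (R := fun I => {x | ∃ i j, i < j ∧ I = {i, j} ∧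
      (x = (3 * i, 3 * j) ∨ x = (3 * i + 2, 3 * j) ∨ x = (3 * i, 3 * j + 2))})
    ((Finset.Icc 1 k).powersetCard 2) (by
      intro I hI
      obtain ⟨hIs, hIc⟩ := Finset.mem_powersetCard.1 hI
      refine ⟨fun h => by have := hF1c I h; omega, ?_⟩
      obtain ⟨i, j, hij, rfl⟩ := sorted_two hIc
      have hi := Finset.mem_Icc.1 (hIs (show i ∈ _ by simp))
      have hj := Finset.mem_Icc.1 (hIs (show j ∈ _ by simp))
      have := hp.item (k := k) hs (ee_mono (i := i) (j := j) (l := j + 1) (by omega)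
        (by omega) (by omega)) rfl (by simp [ee]; omega) (Q := Q1)
        (R := {x | ∃ i' j' : ℕ, i' < j' ∧ ({i, j} : Finset ℕ) = {i', j'} ∧
          (x = (3 * i', 3 * j') ∨ x = (3 * i' + 2, 3 * j') ∨ x = (3 * i', 3 * j' + 2))})
        (by
          intro G hG
          rw [List.mem_singleton] at hG
          subst hG
          exact ⟨2, 3, hp1, by simpa [phi, ee] using hQ1m i hi.1 hi.2⟩)
        (by
          rintro x ⟨i', j', h, he, hx⟩
          have a1 : i' ∈ ({i, j} : Finset ℕ) := by rw [he]; simp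
          have a2 : j' ∈ ({i, j} : Finset ℕ) := by rw [he]; simp
          simp only [Finset.mem_insert, Finset.mem_singleton] at a1 a2
          have b1 : i' = i := by omega
          have b2 : j' = j := by omega
          subst b1 b2
          refine ⟨pair, by simp, ?_⟩
          rcases hx with rfl | rfl | rfl
          · exact ⟨3, 6, by simp [phi, ee], hp2⟩
          · exact ⟨5, 6, by simp [phi, ee], hp3⟩
          · exact ⟨3, 8, by simp [phi, ee], hp4⟩)
      rw [Icc12] at this
      simpa [ee] using this)
  set F2 := (Finset.Icc 1 k).powersetCard 2 ∪ F1 with hF2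
  have hF2c : ∀ I ∈ F2, I.card ≤ 2 := by
    intro I hI
    rcases Finset.mem_union.1 hI with h | h
    · exact (Finset.mem_powersetCard.1 h).2.le
    · exact (hF1c I h).trans (by omega)
  have st3 := st2.steps (R := fun _ => ∅) ((Finset.Icc 1 k).powersetCard 3) (by
      intro I hI
      obtain ⟨hIs, hIc⟩ := Finset.mem_powersetCard.1 hI
      refine ⟨fun h => by have := hF2c I h; omega, ?_⟩
      obtain ⟨i, j, l, hij, hjl, rfl⟩ := sorted_three hIc
      have hi := Finset.mem_Icc.1 (hIs (show i ∈ _ by simp))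
      have hj := Finset.mem_Icc.1 (hIs (show j ∈ _ by simp))
      have hl := Finset.mem_Icc.1 (hIs (show l ∈ _ by simp))
      have hIJ : ({i, j} : Finset ℕ) ∈ (Finset.Icc 1 k).powersetCard 2 := by
        rw [Finset.mem_powersetCard]
        refine ⟨?_, Finset.card_pair (by omega)⟩
        intro x hx
        simp only [Finset.mem_insert, Finset.mem_singleton] at hx
        rw [Finset.mem_Icc]; omega
      have := ht.item (k := k) hs (ee_mono (i := i) (j := j) (l := l) (by omega)
        (by omega) (by omega)) rfl (by simp [ee]; omega) (R := ∅)
        (Q := Q1 ∪ {x | ∃ I ∈ (Finset.Icc 1 k).powersetCard 2,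
          x ∈ {x : ℕ × ℕ | ∃ i j, i < j ∧ I = {i, j} ∧
      (x = (3 * i, 3 * j) ∨ x = (3 * i + 2, 3 * j) ∨ x = (3 * i, 3 * j + 2))}})
        (by
          intro G hG
          simp only [List.mem_cons, List.not_mem_nil, or_false] at hG
          rcases hG with rfl | rfl | rfl
          · exact ⟨3, 6, ⟨⟨_, rfl⟩, ⟨[3, 6, 9, 4, 7, 10, 5, 8, 11], rfl⟩⟩,
              Or.inr ⟨_, hIJ, i, j, hij, rfl, Or.inl (by simp [phi, ee])⟩⟩
          · exact ⟨5, 6, ⟨⟨_, rfl⟩, ⟨[5, 6, 10, 3, 7, 11, 4, 8, 9], rfl⟩⟩,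
              Or.inr ⟨_, hIJ, i, j, hij, rfl, Or.inr (Or.inl (by simp [phi, ee]))⟩⟩
          · exact ⟨3, 8, ⟨⟨_, rfl⟩, ⟨[3, 8, 10, 4, 6, 11, 5, 7, 9], rfl⟩⟩,
              Or.inr ⟨_, hIJ, i, j, hij, rfl, Or.inr (Or.inr (by simp [phi, ee]))⟩⟩)
        (by simp)
      rw [Icc13] at this
      simpa [ee] using this)
  obtain ⟨L, l1, l2, -⟩ := st3
  refine ⟨L, l1, l2.1, fun m => ?_⟩
  rw [l2.2]
  refine ⟨fun h => h.1, fun h => ⟨h, ?_⟩⟩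
  have hsub : gs m ⊆ Finset.Icc 1 k := by
    intro i hi
    obtain ⟨h0, x, hx, rfl⟩ := (mem_gs m i).1 hi
    have := h.2 x hx
    rw [Finset.mem_Icc]; omega
  have hcard : (gs m).card ≤ 3 := by
    refine (Finset.card_le_card (Finset.erase_subset _ _)).trans ?_
    refine (Multiset.toFinset_card_le _).trans ?_
    rw [Multiset.card_map, h.1]
  rw [Finset.mem_union, hF2, Finset.mem_union, Finset.mem_powersetCard, Finset.mem_powersetCard]
  by_cases c3 : (gs m).card = 3
  · exact Or.inl ⟨hsub, c3⟩
  by_cases c2 : (gs m).card = 2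
  · exact Or.inr (Or.inl ⟨hsub, c2⟩)
  right; right
  rw [hF1, Finset.mem_union]
  by_cases c1 : (gs m).card = 1
  · obtain ⟨i, hi⟩ := Finset.card_eq_one.1 c1
    have : i ∈ Finset.Icc 1 k := hsub (by rw [hi]; simp)
    rw [Finset.mem_Icc] at this
    rw [hi]
    by_cases h1 : i = 1
    · right; simp [h1]
    · left; exact Finset.mem_image.2 ⟨i, Finset.mem_Icc.2 (by omega), rfl⟩
  · right
    have : gs m = ∅ := Finset.card_eq_zero.1 (by omega)
    rw [this]; simp

lemma lw_eq : ∀ L : List ℕ, lw L = (List.range (L.length - 2)).map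
    (fun i => ({L.getD i 0, L.getD (i + 1) 0, L.getD (i + 2) 0} : Multiset ℕ))
  | [] => by simp [lw]
  | [a] => by simp [lw]
  | [a, b] => by simp [lw]
  | a :: b :: c :: l => by
    rw [lw, lw_eq (b :: c :: l)]
    have : (a :: b :: c :: l).length - 2 = ((b :: c :: l).length - 2) + 1 := by simp
    rw [this, List.range_succ_eq_map, List.map_cons, List.map_map]
    rfl

lemma cyc_eq {L V : List ℕ} {p q : ℕ} (h1 : ∃ U, L = p :: q :: U) (h2 : L = V ++ [p, q])
    (hV : 2 ≤ V.length) : cycWindows V 3 = lw L := by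
  have key : ∀ i < V.length, ∀ j ≤ 2, V.getD ((i + j) % V.length) 0 = L.getD (i + j) 0 := by
    intro i hi j hj
    rcases Nat.lt_or_ge (i + j) V.length with h | h
    · rw [Nat.mod_eq_of_lt h, h2, List.getD_append _ _ _ _ h]
    · obtain ⟨d, hd⟩ := Nat.exists_eq_add_of_le h
      have hd2 : d < 2 := by omega
      rw [hd, Nat.add_mod_left, Nat.mod_eq_of_lt (by omega)]
      have e1 : V.getD d 0 = L.getD d 0 := by
        rw [h2, List.getD_append _ _ _ _ (by omega)]
      have e2 : L.getD (V.length + d) 0 = [p, q].getD d 0 := by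
        rw [h2, List.getD_append_right _ _ _ _ (by omega)]; simp
      rw [e1, e2]
      obtain ⟨U, rfl⟩ := h1
      interval_cases d <;> rfl
  have hlen : L.length - 2 = V.length := by rw [h2]; simp
  rw [lw_eq, cycWindows, hlen]
  apply List.map_congr_left
  intro i hi
  rw [List.mem_range] at hi
  have k0 := key i hi 0 (by omega)
  have k1 := key i hi 1 (by omega)
  have k2 := key i hi 2 (by omega)
  simp only [cycWindow]
  rw [show List.range 3 = [0, 1, 2] from rfl]
  simp only [List.map_cons, List.map_nil, k0, k1, k2]
  rfl

lemma finish {s k n : ℕ} (hs : 1 ≤ s) (hn : n + s = 3 * k + 3) (hn4 : 4 ≤ n)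
    (h : ∃ L, IsCl L 2 2 ∧ Covers (Ok s k) (lw L)) : ∃ w : List ℕ, IsUcycle n 3 w := by
  obtain ⟨L, ⟨⟨U, hU⟩, ⟨V, hV⟩⟩, hc⟩ := h
  set f : ℕ → ℕ := fun x => x - (s - 1) with hf
  have hback : ∀ m ∈ lw L, (m.map f).map (fun x => x + (s - 1)) = m := by
    intro m hm
    rw [hc.2] at hm
    rw [Multiset.map_map]
    conv_rhs => rw [← Multiset.map_id m]
    refine Multiset.map_congr rfl (fun x hx => ?_)
    have := (hm.2 x hx).1
    simp [hf]; omega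
  have hC : Covers (fun m => Multiset.card m = 3 ∧ ∀ x ∈ m, x ∈ Finset.Icc 1 n)
      (lw (L.map f)) := by
    rw [lw_map]
    refine ⟨List.Nodup.map_on ?_ hc.1, ?_⟩
    · intro a ha b hb hab
      rw [← hback a ha, ← hback b hb, hab]
    · intro m
      rw [List.mem_map]
      constructor
      · rintro ⟨m0, hm0, rfl⟩
        rw [hc.2] at hm0
        refine ⟨by simpa using hm0.1, ?_⟩
        intro y hy
        obtain ⟨x, hx, rfl⟩ := Multiset.mem_map.1 hy
        have := hm0.2 x hx
        rw [Finset.mem_Icc]; simp only [hf]; omega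
      · rintro ⟨h3, hx⟩
        refine ⟨m.map (fun x => x + (s - 1)), ?_, ?_⟩
        · rw [hc.2]
          refine ⟨by simpa using h3, ?_⟩
          intro y hy
          obtain ⟨x, hxm, rfl⟩ := Multiset.mem_map.1 hy
          have := Finset.mem_Icc.1 (hx x hxm)
          constructor <;> omega
        · rw [Multiset.map_map]
          conv_rhs => rw [← Multiset.map_id m]
          refine Multiset.map_congr rfl (fun x hx => ?_)
          simp [hf]
  have hlen : 2 ≤ V.length := by
    have m1 := (hC.2 {1, 1, 1}).2 (by simp; omega)
    have m2 := (hC.2 {2, 2, 2}).2 (by simp; omega)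
    by_contra hlt
    have : (lw (L.map f)).length ≤ 1 := by
      rw [lw_eq, hV]; simp; omega
    rcases hl : lw (L.map f) with _ | ⟨a, _ | ⟨b, t⟩⟩
    · rw [hl] at m1; simp at m1
    · rw [hl, List.mem_singleton] at m1 m2
      have : ({1, 1, 1} : Multiset ℕ) = {2, 2, 2} := m1.trans m2.symm
      exact absurd this (by decide)
    · rw [hl] at this; simp at this
  have hcyc : cycWindows (V.map f) 3 = lw (L.map f) :=
    cyc_eq (p := f 2) (q := f 2) ⟨U.map f, by rw [hU]; rfl⟩ (by rw [hV]; simp) (by simpa using hlen)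
  refine ⟨V.map f, ?_, ?_, ?_, ?_⟩
  · intro h
    have := congrArg List.length h
    simp at this; rw [this] at hlen; simp at hlen
  · intro x hx
    obtain ⟨i, hi, rfl⟩ := List.mem_iff_getElem.1 hx
    have hw : cycWindow (V.map f) 3 i ∈ cycWindows (V.map f) 3 :=
      List.mem_map.2 ⟨i, List.mem_range.2 hi, rfl⟩
    rw [hcyc, hC.2] at hw
    apply hw.2
    rw [cycWindow, Multiset.mem_coe, List.mem_map]
    refine ⟨0, by simp, ?_⟩
    rw [Nat.add_zero, Nat.mod_eq_of_lt hi, List.getD_eq_getElem _ _ hi]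
  · rw [hcyc]; exact hC.1
  · intro m
    rw [hcyc]; exact hC.2 m

end UC3

theorem ucycle_three_multisets_exists (n : ℕ) (hn : 4 ≤ n)
    (hmod : n % 3 = 1 ∨ n % 3 = 2) :
    ∃ w : List ℕ, IsUcycle n 3 w := by
  open UC3 in
  rcases hmod with h | h
  · refine finish (s := 2) (k := n / 3) (by omega) (by omega) hn ?_
    exact full (by omega) (by omega) base1_ok ⟨⟨_, rfl⟩, ⟨base1.dropLast.dropLast, by decide⟩⟩
      (by decide) (by decide) single1_ok ⟨⟨_, rfl⟩, ⟨single1.dropLast.dropLast, by decide⟩⟩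
      (by decide) pair1_ok ⟨⟨_, rfl⟩, ⟨pair1.dropLast.dropLast, by decide⟩⟩
      (by decide) (by decide) (by decide) tri_ok2
  · refine finish (s := 1) (k := n / 3) (by omega) (by omega) hn ?_
    exact full (by omega) (by omega) base2_ok ⟨⟨_, rfl⟩, ⟨base2.dropLast.dropLast, by decide⟩⟩
      (by decide) (by decide) single2_ok ⟨⟨_, rfl⟩, ⟨single2.dropLast.dropLast, by decide⟩⟩
      (by decide) pair2_ok ⟨⟨_, rfl⟩, ⟨pair2.dropLast.dropLast, by decide⟩⟩
      (by decide) (by decide) (by decide) tri_ok1
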